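/- Let G(p) be an infinitesimally rigid framework in ℝ^d whose points affinely span ℝ^d, let i, j be distinct vertices with {i, j} ∉ E, and let w₁ ∈ ℝ. Let Ḡ be the graph obtained from G by adding the edge {i, j}. Then there exists an equilibrium stress w̄ of the framework Ḡ(p) whose value on the added edge {i, j} equals −w₁. -/

import Mathlib

open scoped BigOperators RealInnerProductSpace

noncomputable section

/-- A configuration of a framework: an assignment of points in `ℝ^d` to vertices. -/
abbrev Config (V : Type*) (d : ℕ) := V → EuclideanSpace ℝ (Fin d)

/-- The space of infinitesimal flexes of the framework `G(p)`. -/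
def flexSpace {V : Type*} {d : ℕ} (G : SimpleGraph V) (p : Config V d) :
    Submodule ℝ (V → EuclideanSpace ℝ (Fin d)) where
  carrier := {q | ∀ i j, G.Adj i j → ⟪p i - p j, q i - q j⟫ = (0 : ℝ)}
  zero_mem' := by intro i j _; simp
  add_mem' := by
    intro a b ha hb i j hij
    have h : (a + b) i - (a + b) j = (a i - a j) + (b i - b j) := by
      simp only [Pi.add_apply]; abel
    rw [h, inner_add_right, ha i j hij, hb i j hij, add_zero]
  smul_mem' := by
    intro c a ha i j hij
    have h : (c • a) i - (c • a) j = c • (a i - a j) := by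
      simp only [Pi.smul_apply, smul_sub]
    rw [h, real_inner_smul_right, ha i j hij, mul_zero]

/-- A framework whose points affinely span `ℝ^d` is infinitesimally rigid if its space
of infinitesimal flexes has dimension exactly `d (d + 1) / 2`. -/
def InfinitesimallyRigid {V : Type*} {d : ℕ} (G : SimpleGraph V) (p : Config V d) :
    Prop :=
  affineSpan ℝ (Set.range p) = ⊤ ∧
    Module.finrank ℝ (flexSpace G p) = d * (d + 1) / 2

/-- An equilibrium stress of the framework `G(p)`: a symmetric assignment of reals to
pairs of vertices, vanishing on non-edges, satisfying the equilibrium condition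
`∑_{j : {i,j} ∈ E} w i j • (p i - p j) = 0` at every vertex `i`. -/
def IsEquilibriumStress {V : Type*} [Fintype V] {d : ℕ} (G : SimpleGraph V)
    (p : Config V d) (w : V → V → ℝ) : Prop :=
  (∀ i j, w i j = w j i) ∧ (∀ i j, ¬ G.Adj i j → w i j = 0) ∧
    (∀ i, ∑ j, w i j • (p i - p j) = 0)

/-- Sign of a pair of indices, used to build skew-symmetric matrices. -/
def pairSign {d : ℕ} (a b : Fin d) : ℝ := if a < b then 1 else if b < a then -1 else 0

lemma pairSign_swap {d : ℕ} (a b : Fin d) : pairSign a b = - pairSign b a := by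
  unfold pairSign
  rcases lt_trichotomy a b with h | h | h
  · simp [h, h.not_gt]
  · simp [h]
  · simp [h, h.not_gt]

/-- The trivial flexes, parametrized by functions on unordered pairs of coordinates: the
diagonal gives the translation and the off-diagonal part gives the rotation. -/
def trivialFlex {V : Type*} {d : ℕ} (p : Config V d) :
    (Sym2 (Fin d) → ℝ) →ₗ[ℝ] (V → EuclideanSpace ℝ (Fin d)) where
  toFun g := fun v => WithLp.toLp 2
    (fun a => g s(a, a) + ∑ b, pairSign a b * g s(a, b) * p v b)
  map_add' g h := by
    ext v a
    simp [mul_add, add_mul, Finset.sum_add_distrib]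
    ring
  map_smul' c g := by
    ext v a
    simp only [Pi.smul_apply, smul_eq_mul, RingHom.id_apply, PiLp.smul_apply, mul_add,
      Finset.mul_sum]
    congr 1
    exact Finset.sum_congr rfl fun b _ => by ring

lemma trivialFlex_apply {V : Type*} {d : ℕ} (p : Config V d) (g : Sym2 (Fin d) → ℝ)
    (v : V) (a : Fin d) : trivialFlex p g v a =
      g s(a, a) + ∑ b, pairSign a b * g s(a, b) * p v b := rfl

lemma trivialFlex_inner {V : Type*} {d : ℕ} (p : Config V d) (g : Sym2 (Fin d) → ℝ)
    (u v : V) : ⟪p u - p v, trivialFlex p g u - trivialFlex p g v⟫ = (0 : ℝ) := by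
  have h : ⟪p u - p v, trivialFlex p g u - trivialFlex p g v⟫ =
      ∑ a, ∑ b, pairSign a b * g s(a, b) * ((p u a - p v a) * (p u b - p v b)) := by
    rw [PiLp.inner_apply]
    refine Finset.sum_congr rfl fun a _ => ?_
    simp only [PiLp.sub_apply, trivialFlex_apply, RCLike.inner_apply, conj_trivial]
    rw [add_sub_add_left_eq_sub, ← Finset.sum_sub_distrib, Finset.sum_mul]
    exact Finset.sum_congr rfl fun b _ => by ring
  have h2 : ∑ a, ∑ b, pairSign a b * g s(a, b) * ((p u a - p v a) * (p u b - p v b)) =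
      - ∑ a, ∑ b, pairSign a b * g s(a, b) * ((p u a - p v a) * (p u b - p v b)) := by
    conv_lhs => rw [Finset.sum_comm]
    simp only [← Finset.sum_neg_distrib]
    refine Finset.sum_congr rfl fun a _ => Finset.sum_congr rfl fun b _ => ?_
    rw [pairSign_swap b a, Sym2.eq_swap]
    ring
  rw [h]
  linarith

lemma trivialFlex_injective {V : Type*} {d : ℕ} (p : Config V d)
    (hp : affineSpan ℝ (Set.range p) = ⊤) : Function.Injective (trivialFlex p) := by
  rw [← LinearMap.ker_eq_bot, LinearMap.ker_eq_bot']
  intro g hg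
  have key : ∀ (a : Fin d) (x : EuclideanSpace ℝ (Fin d)),
      g s(a, a) + ∑ b, pairSign a b * g s(a, b) * x b = 0 := by
    intro a x
    have hx : x ∈ affineSpan ℝ (Set.range p) := by rw [hp]; trivial
    refine affineSpan_induction
      (p := fun x => g s(a, a) + ∑ b, pairSign a b * g s(a, b) * x b = 0) hx ?_ ?_
    · rintro _ ⟨v, rfl⟩
      rw [← trivialFlex_apply, hg]
      rfl
    · intro c u v w hu hv hw
      have : ∑ b, pairSign a b * g s(a, b) * (c • (u -ᵥ v) +ᵥ w) b =
          c * (∑ b, pairSign a b * g s(a, b) * u b - ∑ b, pairSign a b * g s(a, b) * v b)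
            + ∑ b, pairSign a b * g s(a, b) * w b := by
        rw [← Finset.sum_sub_distrib, Finset.mul_sum, ← Finset.sum_add_distrib]
        refine Finset.sum_congr rfl fun b _ => ?_
        simp only [vsub_eq_sub, vadd_eq_add, PiLp.add_apply, PiLp.smul_apply, PiLp.sub_apply,
          smul_eq_mul]
        ring
      rw [this]
      linear_combination c * hu - c * hv + hw
  have hd : ∀ a, g s(a, a) = 0 := by
    intro a
    simpa using key a 0
  funext s
  induction s using Sym2.ind with
  | _ a b =>
    rcases eq_or_ne a b with rfl | hab
    · exact hd a
    · have h := key a (EuclideanSpace.single b 1)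
      rw [hd, Finset.sum_eq_single b] at h
      · rcases lt_or_gt_of_ne hab with h1 | h1
        · simpa [pairSign, h1, h1.not_gt] using h
        · simpa [pairSign, h1, h1.not_gt] using h
      · intro c _ hc
        simp [hc]
      · simp

lemma inner_eq_zero_of_rigid {V : Type*} [Fintype V] {d : ℕ} (G : SimpleGraph V)
    (p : Config V d) (hinf : InfinitesimallyRigid G p)
    (q : V → EuclideanSpace ℝ (Fin d)) (hq : q ∈ flexSpace G p) (u v : V) :
    ⟪p u - p v, q u - q v⟫ = (0 : ℝ) := by
  have hle : LinearMap.range (trivialFlex p) ≤ flexSpace G p := by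
    rintro _ ⟨g, rfl⟩ a b _
    exact trivialFlex_inner p g a b
  have heq : LinearMap.range (trivialFlex p) = flexSpace G p := by
    apply Submodule.eq_of_le_of_finrank_eq hle
    rw [hinf.2, LinearMap.finrank_range_of_inj (trivialFlex_injective p hinf.1),
      Module.finrank_fintype_fun_eq_card, Sym2.card, Nat.choose_two_right]
    simp [mul_comm]
  rw [← heq] at hq
  obtain ⟨g, rfl⟩ := hq
  exact trivialFlex_inner p g u v

/-- The row of the rigidity matrix for the pair `u, v`, as a functional. -/
def edgeFunctional {V : Type*} {d : ℕ} (p : Config V d) (u v : V) :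
    (V → EuclideanSpace ℝ (Fin d)) →ₗ[ℝ] ℝ :=
  (innerₛₗ ℝ (p u - p v)).comp
    ((LinearMap.proj u : (V → EuclideanSpace ℝ (Fin d)) →ₗ[ℝ] EuclideanSpace ℝ (Fin d)) -
      LinearMap.proj v)

lemma edgeFunctional_apply {V : Type*} {d : ℕ} (p : Config V d) (u v : V)
    (q : V → EuclideanSpace ℝ (Fin d)) :
    edgeFunctional p u v q = ⟪p u - p v, q u - q v⟫ := rfl

lemma edgeFunctional_swap {V : Type*} {d : ℕ} (p : Config V d) (u v : V) :
    edgeFunctional p u v = edgeFunctional p v u := by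
  ext1 q
  rw [edgeFunctional_apply, edgeFunctional_apply, ← inner_neg_neg, neg_sub, neg_sub]

/-- A symmetric linear dependency of the rows of the rigidity matrix is an equilibrium
of forces. -/
lemma equilibrium_of_functional {V : Type*} [Fintype V] [DecidableEq V] {d : ℕ}
    (p : Config V d) (w : V → V → ℝ) (hs : ∀ u v, w u v = w v u)
    (h : ∀ q, ∑ u, ∑ v, w u v * edgeFunctional p u v q = 0) (x : V) :
    ∑ v, w x v • (p x - p v) = 0 := by
  have hsplit : ∀ q : V → EuclideanSpace ℝ (Fin d),
      ∑ u, ⟪∑ v, w u v • (p u - p v), q u⟫ = (0 : ℝ) := by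
    intro q
    have h1 := h q
    have e1 : ∑ u, ⟪∑ v, w u v • (p u - p v), q u⟫ =
        ∑ u, ∑ v, w u v * ⟪p u - p v, q u⟫ := by
      simp only [sum_inner, real_inner_smul_left]
    have e2 : ∑ u, ∑ v, w u v * ⟪p u - p v, q v⟫ =
        - ∑ u, ∑ v, w u v * ⟪p u - p v, q u⟫ := by
      rw [Finset.sum_comm]
      simp only [← Finset.sum_neg_distrib]
      refine Finset.sum_congr rfl fun a _ => Finset.sum_congr rfl fun b _ => ?_
      rw [hs b a, ← neg_sub (p a) (p b), inner_neg_left]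
      ring
    simp only [edgeFunctional_apply, inner_sub_right _ (q _), mul_sub,
      Finset.sum_sub_distrib] at h1
    rw [e1]
    linarith
  have h2 := hsplit (Pi.single x (∑ v, w x v • (p x - p v)))
  rw [Finset.sum_eq_single x] at h2
  · rw [Pi.single_eq_same] at h2
    exact inner_self_eq_zero.mp h2
  · intro b _ hb
    rw [Pi.single_eq_of_ne hb, inner_zero_right]
  · simp

/-- For an infinitesimally rigid framework `G(p)` in `ℝ^d` whose points affinely span
`ℝ^d`, distinct non-adjacent vertices `i, j`, and any `w₁ ∈ ℝ`, the framework obtained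
by adding the edge `{i, j}` has an equilibrium stress whose value on the added edge is
`-w₁`. -/
theorem exists_equilibriumStress_on_added_edge
    {V : Type*} [Fintype V] [DecidableEq V] {d : ℕ}
    (G : SimpleGraph V) (p : Config V d)
    (hinf : InfinitesimallyRigid G p)
    (i j : V) (hij : i ≠ j) (hnadj : ¬ G.Adj i j) (w₁ : ℝ) :
    ∃ w : V → V → ℝ,
      IsEquilibriumStress (G ⊔ SimpleGraph.fromEdgeSet {s(i, j)}) p w ∧
        w i j = -w₁ := by
  classical
  let L : V × V → (V → EuclideanSpace ℝ (Fin d)) →ₗ[ℝ] ℝ :=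
    fun e => if G.Adj e.1 e.2 then edgeFunctional p e.1 e.2 else 0
  have hmem : edgeFunctional p i j ∈ Submodule.span ℝ (Set.range L) := by
    apply mem_span_of_iInf_ker_le_ker
    intro q hq
    rw [LinearMap.mem_ker, edgeFunctional_apply]
    refine inner_eq_zero_of_rigid G p hinf q ?_ i j
    intro a b hab
    have h1 := (Submodule.mem_iInf _).1 hq (a, b)
    rw [LinearMap.mem_ker] at h1
    simpa [L, hab, edgeFunctional_apply] using h1
  obtain ⟨c, hc⟩ := (Submodule.mem_span_range_iff_exists_fun ℝ).1 hmem
  have hcq : ∀ q, ∑ u, ∑ v, (if G.Adj u v then c (u, v) else 0) * edgeFunctional p u v q =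
      edgeFunctional p i j q := by
    intro q
    rw [← hc, LinearMap.sum_apply, Fintype.sum_prod_type]
    refine Finset.sum_congr rfl fun a _ => Finset.sum_congr rfl fun b _ => ?_
    by_cases hab : G.Adj a b <;> simp [L, hab]
  have hcq' : ∀ q, ∑ u, ∑ v, (if G.Adj u v then c (v, u) else 0) * edgeFunctional p u v q =
      edgeFunctional p i j q := by
    intro q
    rw [← hcq q, Finset.sum_comm]
    refine Finset.sum_congr rfl fun a _ => Finset.sum_congr rfl fun b _ => ?_
    rw [edgeFunctional_swap p b a]
    simp only [G.adj_comm b a]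
  have hdelta : ∀ (x y : V) q, ∑ u, ∑ v, (if u = x ∧ v = y then (1 : ℝ) else 0) *
      edgeFunctional p u v q = edgeFunctional p x y q := by
    intro x y q
    rw [Finset.sum_eq_single x, Finset.sum_eq_single y]
    · simp
    · intro b _ hb
      simp [hb]
    · simp
    · intro b _ hb
      simp [hb]
    · simp
  let w : V → V → ℝ := fun u v =>
    w₁ * ((if G.Adj u v then c (u, v) else 0) + (if G.Adj u v then c (v, u) else 0)
      - (if u = i ∧ v = j then (1 : ℝ) else 0) - (if u = j ∧ v = i then (1 : ℝ) else 0))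
  have hsymm : ∀ u v, w u v = w v u := by
    intro u v
    simp only [w, G.adj_comm v u, and_comm (a := v = i), and_comm (a := v = j)]
    ring
  refine ⟨w, ⟨hsymm, ?_, ?_⟩, ?_⟩
  · intro u v huv
    simp only [SimpleGraph.sup_adj, SimpleGraph.fromEdgeSet_adj, Set.mem_singleton_iff,
      Sym2.eq_iff, not_or] at huv
    obtain ⟨h1, h2⟩ := huv
    have h3 : ¬ (u = i ∧ v = j) := by
      rintro ⟨rfl, rfl⟩
      exact h2 ⟨Or.inl ⟨rfl, rfl⟩, hij⟩
    have h4 : ¬ (u = j ∧ v = i) := by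
      rintro ⟨rfl, rfl⟩
      exact h2 ⟨Or.inr ⟨rfl, rfl⟩, hij.symm⟩
    simp only [w, h1, h3, h4, if_false]
    ring
  · refine equilibrium_of_functional p w hsymm fun q => ?_
    simp only [w, mul_assoc, sub_mul, add_mul, ← Finset.mul_sum, Finset.sum_sub_distrib,
      Finset.sum_add_distrib]
    rw [hcq, hcq', hdelta, hdelta, edgeFunctional_swap p j i]
    ring
  · simp [w, hnadj, hij]
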